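/- arXiv:1511.09455 — 2 statements merged into one kernel-verified Lean document; each statement's English description precedes it below -/
import Mathlib

section
/- Let L and R be binary trees and let B be the binary tree whose root has left subtree L and right subtree R. Then the number of non-ambiguous trees of shape B equals C(|LV(B)|, |LV(R)|) · C(|RV(B)|, |RV(L)|) · |NAT(L)| · |NAT(R)|, where C denotes the binomial coefficient and where by convention |NAT(∅)| = 1 for the empty binary tree. -/
inductive BT : Type where
  | nil : BT
  | node : BT → BT → BT
  deriving DecidableEq

namespace BT

/-- The list of positions (paths from the root, `false` = left step, `true` = right step)
of the vertices of a binary tree. -/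
def paths : BT → List (List Bool)
  | .nil => []
  | .node l r => [] :: (l.paths.map (List.cons false) ++ r.paths.map (List.cons true))

/-- Number of vertices. -/
def size (B : BT) : ℕ := B.paths.length

/-- The set of left children (positions ending with a left step). -/
def leftVertices (B : BT) : Finset (List Bool) :=
  B.paths.toFinset.filter (fun p => p.getLast? = some false)

/-- The set of right children (positions ending with a right step). -/
def rightVertices (B : BT) : Finset (List Bool) :=
  B.paths.toFinset.filter (fun p => p.getLast? = some true)

end BT

/-- A non-ambiguous tree of shape `B`: bijective labellings of the left (resp. right)
children by `Fin |LV B|` (resp. `Fin |RV B|`), decreasing along ancestry. -/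
structure NAT (B : BT) where
  fL : {p // p ∈ B.leftVertices} → Fin B.leftVertices.card
  fR : {p // p ∈ B.rightVertices} → Fin B.rightVertices.card
  bijL : Function.Bijective fL
  bijR : Function.Bijective fR
  ancL : ∀ u v : {p // p ∈ B.leftVertices}, u.1 <+: v.1 → u ≠ v → (fL v : ℕ) < fL u
  ancR : ∀ u v : {p // p ∈ B.rightVertices}, u.1 <+: v.1 → u ≠ v → (fR v : ℕ) < fR u

/-- The order-reversing labellings of `(α, r)` by `β`. -/
def RevLabelling {α : Type*} (r : α → α → Prop) (β : Type*) [LT β] : Type _ :=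
  {e : α ≃ β // ∀ u v, r u v → e v < e u}

namespace RevLabelling

/-- Transport of labellings along isomorphisms of both sides. -/
def congr {α α' β β' : Type*} {r : α → α → Prop} {s : α' → α' → Prop} [Preorder β] [Preorder β']
    (e : r ≃r s) (f : β ≃o β') : RevLabelling r β ≃ RevLabelling s β' :=
  (e.toEquiv.equivCongr f.toEquiv).subtypeEquiv fun g => by
    simp only [Equiv.equivCongr_apply_apply]
    constructor
    · intro h u v huv
      exact f.lt_iff_lt.2 (h _ _ (e.symm.map_rel_iff.2 huv))
    · intro h u v huv
      have := h (e u) (e v) (e.map_rel_iff.2 huv)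
      have hu (w : α) : e.toEquiv.symm (e w) = w := e.toEquiv.symm_apply_apply w
      simp only [hu] at this
      exact f.lt_iff_lt.1 this

instance {α β : Type*} [Finite α] [Finite β] [LT β] (r : α → α → Prop) :
    Finite (RevLabelling r β) :=
  inferInstanceAs (Finite (Subtype _))

theorem isEmpty_of_card_ne {α β : Type*} [LT β] (r : α → α → Prop)
    (h : Nat.card α ≠ Nat.card β) : IsEmpty (RevLabelling r β) :=
  ⟨fun e => h (Nat.card_congr e.1)⟩

/-- Adding a maximum on both sides. -/
theorem card_option {α β : Type*} [LinearOrder β] {r : α → α → Prop}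
    {r' : Option α → Option α → Prop} (hsome : ∀ a b, r' (some a) (some b) ↔ r a b)
    (htop : ∀ a, r' none (some a)) (hnone : ∀ x, ¬ r' x none) :
    Nat.card (RevLabelling r' (WithTop β)) = Nat.card (RevLabelling r β) := by
  symm
  let F : RevLabelling r β → RevLabelling r' (WithTop β) := fun e => ⟨Equiv.optionCongr e.1, by
    rintro (_ | u) (_ | v) h
    · exact (hnone _ h).elim
    · exact WithTop.coe_lt_top _
    · exact (hnone _ h).elim
    · exact WithTop.coe_lt_coe.2 (e.2 _ _ ((hsome _ _).1 h))⟩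
  refine Nat.card_congr (Equiv.ofBijective F ⟨?_, ?_⟩)
  · intro e e' h
    exact Subtype.ext (Equiv.optionCongr_injective (congrArg Subtype.val h))
  · rintro ⟨g, hg⟩
    have hgtop : g none = ⊤ := by
      by_contra hne
      rcases hx : g.symm ⊤ with _ | a
      · exact hne (by rw [← hx, g.apply_symm_apply])
      · have := hg _ _ (htop a)
        rw [← hx, g.apply_symm_apply] at this
        exact not_top_lt this
    have key : ∀ a, ((Equiv.removeNone (β := β) g a : β) : WithTop β) = g (some a) := by
      intro a
      refine Equiv.removeNone_some (β := β) g (Option.ne_none_iff_exists'.1 fun h => ?_)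
      exact Option.some_ne_none a (g.injective (h.trans hgtop.symm))
    refine ⟨⟨Equiv.removeNone (β := β) g, fun u v h => ?_⟩, ?_⟩
    · rw [← WithTop.coe_lt_coe, key, key]
      exact hg _ _ ((hsome _ _).2 h)
    · apply Subtype.ext
      ext1 x
      rcases x with _ | a
      · exact hgtop.symm
      · exact key a

/-- A labelling of a disjoint union is a splitting of the labels with a labelling of each part. -/
noncomputable def sumEquiv {α α' β : Type*} [Finite α] [LinearOrder β]
    (r : α → α → Prop) (s : α' → α' → Prop) :
    (Σ S : Finset β, RevLabelling r {x // x ∈ S} × RevLabelling s {x // x ∉ S}) ≃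
      RevLabelling (Sum.LiftRel r s) β := by
  refine Equiv.ofBijective (fun p => ⟨(Equiv.sumCongr p.2.1.1 p.2.2.1).trans
    (Equiv.sumCompl (· ∈ p.1)), ?_⟩) ⟨?_, ?_⟩
  · rintro _ _ (⟨h⟩ | ⟨h⟩)
    · exact p.2.1.2 _ _ h
    · exact p.2.2.2 _ _ h
  · rintro ⟨S, e, f⟩ ⟨S', e', f'⟩ h
    have h' := fun x => DFunLike.congr_fun (congrArg Subtype.val h) x
    have hl : ∀ a, (e.1 a : β) = e'.1 a := fun a => h' (.inl a)
    have hr : ∀ a, (f.1 a : β) = f'.1 a := fun a => h' (.inr a)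
    obtain rfl : S = S' := by
      ext x
      constructor
      · intro hx
        have := hl (e.1.symm ⟨x, hx⟩)
        rw [Equiv.apply_symm_apply] at this
        exact (show x = _ from this) ▸ Subtype.property _
      · intro hx
        have := hl (e'.1.symm ⟨x, hx⟩)
        rw [Equiv.apply_symm_apply] at this
        exact (show _ = x from this) ▸ Subtype.property _
    obtain rfl : e = e' := Subtype.ext (Equiv.ext fun a => Subtype.ext (hl a))
    obtain rfl : f = f' := Subtype.ext (Equiv.ext fun a => Subtype.ext (hr a))
    rfl
  · rintro ⟨g, hg⟩
    have hfin : (Set.range (g ∘ Sum.inl)).Finite := Set.finite_range _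
    have hl : ∀ a, g (.inl a) ∈ hfin.toFinset := by simp
    have hr : ∀ a, g (.inr a) ∉ hfin.toFinset := by simp
    refine ⟨⟨hfin.toFinset, ⟨Equiv.ofBijective (fun a => ⟨g (.inl a), hl a⟩) ⟨?_, ?_⟩, ?_⟩,
      ⟨Equiv.ofBijective (fun a => ⟨g (.inr a), hr a⟩) ⟨?_, ?_⟩, ?_⟩⟩, ?_⟩
    · intro a b h
      simpa using h
    · rintro ⟨x, hx⟩
      simpa using hx
    · intro u v h
      exact hg _ _ (.inl h)
    · intro a b h
      simpa using h
    · rintro ⟨x, hx⟩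
      obtain ⟨a | a, rfl⟩ := g.surjective x
      · exact (hx (hl a)).elim
      · exact ⟨a, rfl⟩
    · intro u v h
      exact hg _ _ (.inr h)
    · apply Subtype.ext
      ext1 (a | a) <;> rfl

end RevLabelling

/-- The number of order-reversing labellings of `(α, r)` by `0, …, |α| - 1`. -/
noncomputable def numRevLabelling {α : Type*} (r : α → α → Prop) : ℕ :=
  Nat.card (RevLabelling r (Fin (Nat.card α)))

theorem card_revLabelling {α β : Type*} [Finite β] [LinearOrder β] (r : α → α → Prop)
    (h : Nat.card β = Nat.card α) : Nat.card (RevLabelling r β) = numRevLabelling r := by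
  have := Fintype.ofFinite β
  exact Nat.card_congr (RevLabelling.congr (RelIso.refl r)
    (Fintype.orderIsoFinOfCardEq β (by rw [← Nat.card_eq_fintype_card, h])).symm)

theorem numRevLabelling_congr {α α' : Type*} {r : α → α → Prop} {s : α' → α' → Prop}
    (e : r ≃r s) : numRevLabelling r = numRevLabelling s :=
  Nat.card_congr (RevLabelling.congr e (Fin.castOrderIso (Nat.card_congr e.toEquiv)))

theorem numRevLabelling_option {α : Type*} [Finite α] {r : α → α → Prop}
    {r' : Option α → Option α → Prop} (hsome : ∀ a b, r' (some a) (some b) ↔ r a b)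
    (htop : ∀ a, r' none (some a)) (hnone : ∀ x, ¬ r' x none) :
    numRevLabelling r' = numRevLabelling r := by
  have : Finite (WithTop (Fin (Nat.card α))) := inferInstanceAs (Finite (Option _))
  rw [← card_revLabelling (β := WithTop (Fin (Nat.card α))) r',
    RevLabelling.card_option hsome htop hnone]
  · rfl
  · rw [Finite.card_option]
    exact (Finite.card_option (α := Fin (Nat.card α))).trans (by simp)

theorem numRevLabelling_sum {α α' : Type*} [Finite α] [Finite α']
    (r : α → α → Prop) (s : α' → α' → Prop) :
    numRevLabelling (Sum.LiftRel r s) =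
      (Nat.card α + Nat.card α').choose (Nat.card α') *
        (numRevLabelling r * numRevLabelling s) := by
  rw [← card_revLabelling (β := Fin (Nat.card α + Nat.card α')) _ (by simp [Nat.card_sum]),
    ← Nat.card_congr (RevLabelling.sumEquiv r s), Nat.card_sigma]
  have key (S : Finset (Fin (Nat.card α + Nat.card α'))) :
      Nat.card (RevLabelling r {x // x ∈ S} × RevLabelling s {x // x ∉ S}) =
        if S.card = Nat.card α then numRevLabelling r * numRevLabelling s else 0 := by
    rw [Nat.card_prod]
    split_ifs with h
    · rw [card_revLabelling r (by simpa using h), card_revLabelling s]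
      rw [Nat.card_eq_fintype_card, Fintype.card_subtype_compl]
      simp [h]
    · have := RevLabelling.isEmpty_of_card_ne (β := {x // x ∈ S}) r (by simpa using Ne.symm h)
      simp
  simp_rw [key]
  rw [Finset.sum_ite, Finset.sum_const_zero, add_zero, Finset.sum_const, smul_eq_mul,
    ← Finset.powerset_univ, ← Finset.powersetCard_eq_filter, Finset.card_powersetCard,
    Finset.card_univ, Fintype.card_fin, Nat.choose_symm_add]

/-- Strict ancestry between the positions in `S`. -/
def StrictPrefix (S : Finset (List Bool)) (u v : {p // p ∈ S}) : Prop :=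
  u.1 <+: v.1 ∧ u ≠ v

theorem numRevLabelling_strictPrefix_insert_nil {S : Finset (List Bool)} (h : [] ∉ S) :
    numRevLabelling (StrictPrefix (insert [] S)) = numRevLabelling (StrictPrefix S) := by
  let e := (Finset.subtypeInsertEquivOption h).symm
  have he : ∀ x : Option {p // p ∈ S}, (e x).1 = x.elim [] Subtype.val := by
    rintro (_ | x) <;> rfl
  rw [← numRevLabelling_congr (r := fun u v => StrictPrefix (insert [] S) (e u) (e v))
    ⟨e, Iff.rfl⟩]
  refine numRevLabelling_option ?_ ?_ ?_
  · intro a b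
    simp [StrictPrefix, he]
  · intro a
    simp [StrictPrefix, he]
  · rintro (_ | a)
    · simp [StrictPrefix]
    · have : a.1 ≠ [] := fun h' => h (h' ▸ a.2)
      simp [StrictPrefix, he, this]

/-- Grafting two sets of positions below distinct steps from a common root. -/
theorem numRevLabelling_strictPrefix_graft (b : Bool) (S T : Finset (List Bool)) :
    numRevLabelling (StrictPrefix (S.image (List.cons b) ∪ T.image (List.cons !b))) =
      (S.image (List.cons b) ∪ T.image (List.cons !b)).card.choose T.card *
        (numRevLabelling (StrictPrefix S) * numRevLabelling (StrictPrefix T)) := by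
  let F : {p // p ∈ S} ⊕ {p // p ∈ T} →
      {p // p ∈ S.image (List.cons b) ∪ T.image (List.cons !b)} :=
    Sum.elim (fun p => ⟨b :: p.1, by simp⟩) (fun p => ⟨(!b) :: p.1, by simp⟩)
  have hF : Function.Bijective F := by
    constructor
    · rintro (⟨x, hx⟩ | ⟨x, hx⟩) (⟨y, hy⟩ | ⟨y, hy⟩) h <;> simp_all [F]
    · rintro ⟨p, hp⟩
      rcases Finset.mem_union.1 hp with hp' | hp' <;> obtain ⟨q, hq, rfl⟩ := Finset.mem_image.1 hp'
      · exact ⟨.inl ⟨q, hq⟩, rfl⟩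
      · exact ⟨.inr ⟨q, hq⟩, rfl⟩
  have hcard := Nat.card_congr (Equiv.ofBijective F hF)
  rw [Nat.card_sum] at hcard
  rw [← numRevLabelling_congr (r := Sum.LiftRel (StrictPrefix S) (StrictPrefix T))
    ⟨Equiv.ofBijective F hF, ?_⟩, numRevLabelling_sum, hcard,
    Nat.card_eq_finsetCard, Nat.card_eq_finsetCard]
  · rintro (⟨x, hx⟩ | ⟨x, hx⟩) (⟨y, hy⟩ | ⟨y, hy⟩) <;> simp [F, StrictPrefix]

namespace BT

/-- The vertices whose last step is `b`. -/
def sideVertices (b : Bool) (B : BT) : Finset (List Bool) :=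
  B.paths.toFinset.filter (fun p => p.getLast? = some b)

theorem nil_mem_paths {B : BT} : [] ∈ B.paths ↔ B ≠ nil := by
  cases B <;> simp [paths]

theorem cons_mem_paths_node {c : Bool} {p : List Bool} {L R : BT} :
    c :: p ∈ (node L R).paths ↔ p ∈ (cond c R L).paths := by
  cases c <;> simp [paths]

theorem sideVertices_node (b : Bool) (L R : BT) :
    (node L R).sideVertices b =
      (if cond b R L = nil then ∅ else insert [] ((cond b R L).sideVertices b)).image
        (List.cons b) ∪ ((cond b L R).sideVertices b).image (List.cons !b) := by
  ext p
  rcases p with _ | ⟨c, p⟩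
  · simp [sideVertices]
  have hcons (S T : Finset (List Bool)) :
      c :: p ∈ S.image (List.cons b) ∪ T.image (List.cons !b) ↔
        c = b ∧ p ∈ S ∨ c = !b ∧ p ∈ T := by
    simp only [Finset.mem_union, Finset.mem_image, List.cons.injEq]
    grind
  rw [hcons]
  simp only [sideVertices, Finset.mem_filter, List.mem_toFinset, cons_mem_paths_node]
  rcases p with _ | ⟨d, p⟩
  · by_cases h : cond b R L = nil <;> simp only [h, nil_mem_paths] <;>
      rcases b.eq_or_eq_not c with rfl | rfl <;> simp [h]
  · rw [List.getLast?_cons_cons]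
    rcases b.eq_or_eq_not c with rfl | rfl
    · by_cases h : cond b R L = nil <;> simp [h, paths]
    · simp

theorem numRevLabelling_sideVertices_node (b : Bool) (L R : BT) :
    numRevLabelling (StrictPrefix ((node L R).sideVertices b)) =
      ((node L R).sideVertices b).card.choose ((cond b L R).sideVertices b).card *
        (numRevLabelling (StrictPrefix ((cond b R L).sideVertices b)) *
          numRevLabelling (StrictPrefix ((cond b L R).sideVertices b))) := by
  rw [sideVertices_node, numRevLabelling_strictPrefix_graft]
  have hroot : numRevLabelling (StrictPrefix
      (if cond b R L = nil then ∅ else insert [] ((cond b R L).sideVertices b))) =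
      numRevLabelling (StrictPrefix ((cond b R L).sideVertices b)) := by
    by_cases h : cond b R L = nil
    · rw [if_pos h, h, show nil.sideVertices b = ∅ from rfl]
    · rw [if_neg h, numRevLabelling_strictPrefix_insert_nil (by simp [sideVertices])]
  rw [hroot]

end BT

/-- A non-ambiguous tree is a pair of independent labellings of the left and right children. -/
noncomputable def NAT.equivProd (B : BT) :
    NAT B ≃ RevLabelling (StrictPrefix (B.sideVertices false)) (Fin (B.sideVertices false).card) ×
      RevLabelling (StrictPrefix (B.sideVertices true)) (Fin (B.sideVertices true).card) where
  toFun t := (⟨Equiv.ofBijective t.fL t.bijL, fun u v h => t.ancL u v h.1 h.2⟩,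
    ⟨Equiv.ofBijective t.fR t.bijR, fun u v h => t.ancR u v h.1 h.2⟩)
  invFun p := ⟨p.1.1, p.2.1, p.1.1.bijective, p.2.1.bijective,
    fun u v h h' => p.1.2 u v ⟨h, h'⟩, fun u v h h' => p.2.2 u v ⟨h, h'⟩⟩
  left_inv _ := rfl
  right_inv _ := Prod.ext (Subtype.ext (Equiv.ext fun _ => rfl))
    (Subtype.ext (Equiv.ext fun _ => rfl))

theorem NAT.card_eq (B : BT) :
    Nat.card (NAT B) = numRevLabelling (StrictPrefix (B.sideVertices false)) *
      numRevLabelling (StrictPrefix (B.sideVertices true)) := by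
  rw [Nat.card_congr (NAT.equivProd B), Nat.card_prod, card_revLabelling _ (by simp),
    card_revLabelling _ (by simp)]

/-- For `B = node L R`,
`|NAT(B)| = C(|LV(B)|, |LV(R)|) · C(|RV(B)|, |RV(L)|) · |NAT(L)| · |NAT(R)|`
(with the convention `|NAT(∅)| = 1`, which holds for `Nat.card`). -/
theorem nat_card_node (L R : BT) :
    Nat.card (NAT (BT.node L R)) =
      Nat.choose (BT.node L R).leftVertices.card R.leftVertices.card *
        Nat.choose (BT.node L R).rightVertices.card L.rightVertices.card *
        Nat.card (NAT L) * Nat.card (NAT R) := by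
  change _ = Nat.choose ((BT.node L R).sideVertices false).card (R.sideVertices false).card *
    Nat.choose ((BT.node L R).sideVertices true).card (L.sideVertices true).card * _ * _
  simp only [NAT.card_eq, BT.numRevLabelling_sideVertices_node, cond_false, cond_true]
  ring
end

section
/- For all natural numbers w, h, the following identity holds in the polynomial ring ℤ[α,β]: Σ_T α^{LO(T)} β^{RO(T)} = Σ_{p≥1} (p−1)! · (∏_{j=0}^{p−2} (α+β+j)) · S_{2,α}(w+1, p) · S_{2,β}(h+1, p), where the left sum runs over all non-ambiguous trees T of nonempty shape with exactly w left children and h right children (the right sum is finite, the p-th summand vanishing for p > min(w,h)+1). -/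
namespace BT

/-- Length of the leftmost branch (left spine) of a binary tree, counting its root. -/
def leftChain : BT → ℕ
  | .nil => 0
  | .node l _ => l.leftChain + 1

/-- Length of the rightmost branch (right spine) of a binary tree, counting its root. -/
def rightChain : BT → ℕ
  | .nil => 0
  | .node _ r => r.rightChain + 1

/-- `LO`: the number of left children on the leftmost branch of the root. -/
def lo : BT → ℕ
  | .nil => 0
  | .node l _ => l.leftChain

/-- `RO`: the number of right children on the rightmost branch of the root. -/
def ro : BT → ℕ
  | .nil => 0
  | .node _ r => r.rightChain

end BT

/-- The number of non-ambiguous trees (over all nonempty shapes) with `a` left children,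
`b` right children, `LO = i` and `RO = j`. -/
noncomputable def natCountLR (a b i j : ℕ) : ℕ :=
  Nat.card {T : Σ B : BT, NAT B //
    T.1 ≠ BT.nil ∧ T.1.leftVertices.card = a ∧ T.1.rightVertices.card = b ∧
      T.1.lo = i ∧ T.1.ro = j}

/-- The `q`-analogue of the Stirling numbers of the second kind:
`qStirling q n p = Σ_P q^{|B₁|−1}`, where `P` runs over the partitions of `{1,…,n}` into `p`
nonempty blocks and `B₁` is the block containing `1` (via the standard recurrence
obtained by removing the largest element). -/
def qStirling {R : Type*} [CommRing R] (q : R) : ℕ → ℕ → R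
  | 0, 0 => 1
  | 0, _ + 1 => 0
  | _ + 1, 0 => 0
  | n + 1, p + 1 => qStirling q n p + (q + (p : R)) * qStirling q n (p + 1)


section Algebra

variable {R : Type*} [CommRing R]

/-- Binomial convolution of two sequences. -/
def binomConv (f g : ℕ → R) (n : ℕ) : R :=
  ∑ x ∈ Finset.HasAntidiagonal.antidiagonal n, (n.choose x.1 : R) * (f x.1 * g x.2)

theorem binomConv_zero (f g : ℕ → R) : binomConv f g 0 = f 0 * g 0 := by
  simp [binomConv]

theorem binomConv_succ (f g : ℕ → R) (n : ℕ) :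
    binomConv f g (n + 1) =
      binomConv (fun i => f (i + 1)) g n + binomConv f (fun i => g (i + 1)) n := by
  unfold binomConv
  rw [Finset.sum_antidiagonal_choose_succ_mul (fun i j => f i * g j), add_comm]
  congr 1
  refine Finset.sum_congr rfl fun x hx => ?_
  rw [Nat.choose_symm_of_eq_add (Finset.HasAntidiagonal.mem_antidiagonal.1 hx).symm]

theorem binomConv_add_left (f f' g : ℕ → R) (n : ℕ) :
    binomConv (fun i => f i + f' i) g n = binomConv f g n + binomConv f' g n := by
  simp only [binomConv, ← Finset.sum_add_distrib]
  exact Finset.sum_congr rfl fun x _ => by ring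

theorem binomConv_add_right (f g g' : ℕ → R) (n : ℕ) :
    binomConv f (fun i => g i + g' i) n = binomConv f g n + binomConv f g' n := by
  simp only [binomConv, ← Finset.sum_add_distrib]
  exact Finset.sum_congr rfl fun x _ => by ring

theorem binomConv_mul_left (c : R) (f g : ℕ → R) (n : ℕ) :
    binomConv (fun i => c * f i) g n = c * binomConv f g n := by
  simp only [binomConv, Finset.mul_sum]
  exact Finset.sum_congr rfl fun x _ => by ring

theorem binomConv_mul_right (c : R) (f g : ℕ → R) (n : ℕ) :
    binomConv f (fun i => c * g i) n = c * binomConv f g n := by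
  simp only [binomConv, Finset.mul_sum]
  exact Finset.sum_congr rfl fun x _ => by ring

/-- The rising factorial `a (a + 1) ⋯ (a + k - 1)`. -/
def risingFactorial (a : R) (k : ℕ) : R := ∏ j ∈ Finset.range k, (a + (j : R))

theorem risingFactorial_zero (a : R) : risingFactorial a 0 = 1 := by
  simp [risingFactorial]

theorem risingFactorial_succ (a : R) (k : ℕ) :
    risingFactorial a (k + 1) = risingFactorial a k * (a + k) :=
  Finset.prod_range_succ _ _

theorem risingFactorial_succ' (a : R) (k : ℕ) :
    risingFactorial a (k + 1) = a * risingFactorial (a + 1) k := by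
  unfold risingFactorial
  rw [Finset.prod_range_succ', mul_comm]
  simp only [Nat.cast_zero, add_zero, Nat.cast_succ]
  congr 1
  exact Finset.prod_congr rfl fun x _ => by ring

theorem binomConv_risingFactorial (a b : R) (n : ℕ) :
    binomConv (risingFactorial a) (risingFactorial b) n = risingFactorial (a + b) n := by
  induction n with
  | zero => simp [binomConv_zero, risingFactorial_zero]
  | succ n ih =>
    rw [binomConv_succ, risingFactorial_succ, ← ih]
    simp only [risingFactorial_succ, binomConv, Finset.sum_mul, ← Finset.sum_add_distrib]
    refine Finset.sum_congr rfl fun x hx => ?_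
    rw [← Finset.HasAntidiagonal.mem_antidiagonal.1 hx]
    push_cast
    ring

theorem qStirling_succ_zero (q : R) (n : ℕ) : qStirling q (n + 1) 0 = 0 := rfl

theorem qStirling_succ_succ (q : R) (n p : ℕ) :
    qStirling q (n + 1) (p + 1) = qStirling q n p + (q + (p : R)) * qStirling q n (p + 1) := rfl

theorem qStirling_one (q : R) (k : ℕ) : qStirling q 1 (k + 1) = if k = 0 then 1 else 0 := by
  cases k <;> simp [qStirling]

theorem qStirling_eq_zero_of_lt (q : R) {n p : ℕ} (h : n < p) : qStirling q n p = 0 := by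
  induction n generalizing p with
  | zero =>
    obtain ⟨p, rfl⟩ := Nat.exists_eq_succ_of_ne_zero h.ne'
    rfl
  | succ n ih =>
    obtain ⟨p, rfl⟩ := Nat.exists_eq_succ_of_ne_zero (Nat.ne_zero_of_lt h)
    rw [Nat.succ_eq_add_one, qStirling_succ_succ, ih (by omega), ih (by omega)]
    simp

theorem qStirling_succ_one (q : R) (n : ℕ) : qStirling q (n + 1) 1 = q ^ n := by
  induction n with
  | zero => simp [qStirling]
  | succ n ih =>
    rw [qStirling_succ_succ, qStirling_succ_zero, ih]
    simp [pow_succ']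

theorem qStirling_add_one (q : R) (n k : ℕ) :
    qStirling (q + 1) (n + 1) (k + 1) =
      qStirling q (n + 1) (k + 1) + (k + 1) * qStirling q (n + 1) (k + 2) := by
  induction n generalizing k with
  | zero =>
    simp [qStirling_one, show k + 2 = (k + 1) + 1 from rfl]
  | succ n ih =>
    rw [qStirling_succ_succ, qStirling_succ_succ q, qStirling_succ_succ q (n + 1) (k + 1), ih k]
    cases k with
    | zero => simp [qStirling_succ_zero]; ring
    | succ k => rw [ih k]; push_cast; ring

theorem binomConv_qStirling (s t : R) (k l n : ℕ) :
    binomConv (fun i => qStirling s (i + 1) (k + 1)) (fun i => qStirling t (i + 1) (l + 1)) n =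
      ((k + l).choose k : R) * qStirling (s + t) (n + 1) (k + l + 1) := by
  induction n generalizing k l with
  | zero =>
    rw [binomConv_zero]
    rcases k with _ | k <;> rcases l with _ | l <;> simp [qStirling_one]
  | succ n ih =>
    rw [binomConv_succ]
    simp only [qStirling_succ_succ _ (_ + 1)]
    rw [binomConv_add_left, binomConv_add_right, binomConv_mul_left, binomConv_mul_right, ih]
    rcases k with _ | k <;> rcases l with _ | l
    · simp [qStirling_succ_zero, binomConv]; ring
    · rw [ih]
      simp [qStirling_succ_zero, binomConv]
      ring
    · rw [ih]
      simp [qStirling_succ_zero, binomConv]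
      ring
    · rw [ih, ih]
      have h : ((k + 1 + (l + 1)).choose (k + 1) : R) =
          ((k + (l + 1)).choose k : R) + ((k + 1 + l).choose (k + 1) : R) := by
        rw [show k + 1 + (l + 1) = (k + 1 + l) + 1 by ring, Nat.choose_succ_succ,
          show k + (l + 1) = k + 1 + l by ring]
        push_cast
        rfl
      rw [h, show k + (l + 1) + 1 = k + 1 + (l + 1) by ring,
        show k + 1 + l + 1 = k + 1 + (l + 1) by ring]
      push_cast
      ring

/-- Binomial convolution of two double sequences. -/
def binomConv₂ (f g : ℕ → ℕ → R) (m n : ℕ) : R :=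
  ∑ x ∈ Finset.HasAntidiagonal.antidiagonal m, ∑ y ∈ Finset.HasAntidiagonal.antidiagonal n,
    (m.choose x.1 : R) * (n.choose y.1 : R) * (f x.1 y.1 * g x.2 y.2)

theorem binomConv₂_congr {f f' g g' : ℕ → ℕ → R} {m n : ℕ}
    (hf : ∀ i ≤ m, ∀ j ≤ n, f i j = f' i j) (hg : ∀ i ≤ m, ∀ j ≤ n, g i j = g' i j) :
    binomConv₂ f g m n = binomConv₂ f' g' m n := by
  refine Finset.sum_congr rfl fun x hx => Finset.sum_congr rfl fun y hy => ?_
  have hx := Finset.HasAntidiagonal.mem_antidiagonal.1 hx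
  have hy := Finset.HasAntidiagonal.mem_antidiagonal.1 hy
  rw [hf _ (by omega) _ (by omega), hg _ (by omega) _ (by omega)]

theorem binomConv₂_mul (f f' g g' : ℕ → R) (m n : ℕ) :
    binomConv₂ (fun i j => f i * f' j) (fun i j => g i * g' j) m n =
      binomConv f g m * binomConv f' g' n := by
  simp only [binomConv₂, binomConv, Finset.sum_mul_sum]
  exact Finset.sum_congr rfl fun x _ => Finset.sum_congr rfl fun y _ => by ring

theorem binomConv₂_sum {ι κ : Type*} (s : Finset ι) (t : Finset κ) (c : ι → R) (d : κ → R)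
    (f : ι → ℕ → ℕ → R) (g : κ → ℕ → ℕ → R) (m n : ℕ) :
    binomConv₂ (fun i j => ∑ k ∈ s, c k * f k i j) (fun i j => ∑ l ∈ t, d l * g l i j) m n =
      ∑ k ∈ s, ∑ l ∈ t, c k * d l * binomConv₂ (f k) (g l) m n := by
  simp only [binomConv₂, Finset.sum_mul_sum]
  simp only [Finset.mul_sum]
  refine ((Finset.sum_congr rfl fun x _ => Finset.sum_comm).trans Finset.sum_comm).trans ?_
  refine Finset.sum_congr rfl fun k _ => ?_
  refine ((Finset.sum_congr rfl fun x _ => Finset.sum_comm).trans Finset.sum_comm).trans ?_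
  exact Finset.sum_congr rfl fun l _ => Finset.sum_congr rfl fun x _ =>
    Finset.sum_congr rfl fun y _ => by ring

/-- The coefficients of `exp (s x + t y) (1 - (exp x - 1) (exp y - 1)) ^ (-(s + t))` as a
doubly exponential generating function. -/
def natPoly (s t : R) (m n : ℕ) : R :=
  ∑ k ∈ Finset.range (min m n + 1), (k.factorial : R) * risingFactorial (s + t) k *
    (qStirling s (m + 1) (k + 1) * qStirling t (n + 1) (k + 1))

theorem natPoly_eq_sum_range (s t : R) {m n N : ℕ} (h : min m n < N) :
    natPoly s t m n =
      ∑ k ∈ Finset.range N, (k.factorial : R) * risingFactorial (s + t) k *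
        (qStirling s (m + 1) (k + 1) * qStirling t (n + 1) (k + 1)) := by
  refine Finset.sum_subset (Finset.range_subset_range.2 h) fun k _ hk => ?_
  rw [Finset.mem_range, not_lt, Nat.succ_le_iff, min_lt_iff] at hk
  rcases hk with hk | hk
  · rw [qStirling_eq_zero_of_lt s (by omega)]; simp
  · rw [qStirling_eq_zero_of_lt t (by omega)]; simp

theorem natPoly_comm (s t : R) (m n : ℕ) : natPoly s t m n = natPoly t s n m := by
  unfold natPoly
  rw [min_comm, add_comm s t]
  exact Finset.sum_congr rfl fun k _ => by ring

theorem binomConv₂_natPoly (s t s' t' : R) (m n : ℕ) :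
    binomConv₂ (natPoly s t) (natPoly s' t') m n = natPoly (s + s') (t + t') m n := by
  rw [binomConv₂_congr (fun i hi j _ => natPoly_eq_sum_range s t (N := m + 1) (by omega))
      (fun i hi j _ => natPoly_eq_sum_range s' t' (N := m + 1) (by omega)),
    binomConv₂_sum (f := fun k i j => qStirling s (i + 1) (k + 1) * qStirling t (j + 1) (k + 1))
      (g := fun k i j => qStirling s' (i + 1) (k + 1) * qStirling t' (j + 1) (k + 1)),
    natPoly_eq_sum_range (N := m + 1) _ _ (by omega)]
  simp only [binomConv₂_mul, binomConv_qStirling]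
  trans ∑ k ∈ Finset.range (m + 1), ∑ l ∈ Finset.range (m + 1 - k),
      (k.factorial : R) * risingFactorial (s + t) k *
        ((l.factorial : R) * risingFactorial (s' + t') l) *
        (((k + l).choose k : R) * qStirling (s + s') (m + 1) (k + l + 1) *
          (((k + l).choose k : R) * qStirling (t + t') (n + 1) (k + l + 1)))
  · refine Finset.sum_congr rfl fun k _ => Eq.symm ?_
    refine Finset.sum_subset (Finset.range_subset_range.2 (by omega)) fun l _ hl => ?_
    rw [Finset.mem_range] at hl
    rw [qStirling_eq_zero_of_lt (s + s') (by omega)]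
    simp
  · rw [← Finset.sum_range_diag_flip]
    refine Finset.sum_congr rfl fun r _ => ?_
    rw [show s + s' + (t + t') = (s + t) + (s' + t') by ring, ← binomConv_risingFactorial,
      binomConv, Finset.Nat.sum_antidiagonal_eq_sum_range_succ_mk, Finset.mul_sum, Finset.sum_mul]
    refine Finset.sum_congr rfl fun k hk => ?_
    have hk : k ≤ r := by simpa [Nat.lt_succ_iff] using hk
    rw [Nat.add_sub_cancel' hk, ← Nat.choose_mul_factorial_mul_factorial hk]
    push_cast
    ring

theorem natPoly_zero_succ_left (s : R) (m n : ℕ) :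
    natPoly s 0 (m + 1) n = s * natPoly s 1 m n := by
  rw [natPoly_eq_sum_range (N := m + n + 2) _ _ (by omega),
    natPoly_eq_sum_range (N := m + n + 2) _ _ (by omega), Finset.mul_sum]
  have h1 : ∀ k, s * ((k.factorial : R) * risingFactorial (s + 1) k *
      (qStirling s (m + 1) (k + 1) * qStirling 1 (n + 1) (k + 1))) =
      (k.factorial : R) * risingFactorial s (k + 1) *
        (qStirling s (m + 1) (k + 1) * qStirling 0 (n + 1) (k + 1)) +
      ((k + 1).factorial : R) * risingFactorial s (k + 1) *
        (qStirling s (m + 1) (k + 1) * qStirling 0 (n + 1) (k + 2)) := by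
    intro k
    have := qStirling_add_one (0 : R) n k
    rw [zero_add] at this
    rw [this, risingFactorial_succ', Nat.factorial_succ]
    push_cast
    ring
  have h2 : ∀ k, (k.factorial : R) * risingFactorial (s + 0) k *
      (qStirling s (m + 1 + 1) (k + 1) * qStirling 0 (n + 1) (k + 1)) =
      (k.factorial : R) * risingFactorial s (k + 1) *
        (qStirling s (m + 1) (k + 1) * qStirling 0 (n + 1) (k + 1)) +
      (k.factorial : R) * risingFactorial s k *
        (qStirling s (m + 1) k * qStirling 0 (n + 1) (k + 1)) := by
    intro k
    rw [add_zero, qStirling_succ_succ, risingFactorial_succ]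
    ring
  simp only [h1, h2, Finset.sum_add_distrib]
  congr 1
  rw [Finset.sum_range_succ', Finset.sum_range_succ _ (m + n + 1), qStirling_succ_zero,
    qStirling_eq_zero_of_lt s (show m + 1 < m + n + 1 + 1 by omega)]
  simp

theorem natPoly_zero_left (s : R) (n : ℕ) : natPoly s 0 0 n = if n = 0 then 1 else 0 := by
  simp [natPoly, qStirling_succ_one, risingFactorial_zero, zero_pow_eq]

theorem natPoly_zero_succ_right (t : R) (m n : ℕ) :
    natPoly 0 t m (n + 1) = t * natPoly 1 t m n := by
  rw [natPoly_comm, natPoly_zero_succ_left, natPoly_comm]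

theorem natPoly_zero_right (t : R) (m : ℕ) : natPoly 0 t m 0 = if m = 0 then 1 else 0 := by
  rw [natPoly_comm, natPoly_zero_left]

end Algebra

/-- Bijective labellings of `P` by `K` that decrease along the relation `r`. -/
def DecreasingLabelling (P : Type*) (r : P → P → Prop) (K : Type*) [LT K] : Type _ :=
  {f : P → K // Function.Bijective f ∧ ∀ u v, r u v → f v < f u}

namespace DecreasingLabelling

variable {P Q K : Type*}

theorem card_congr [LT K] {r : P → P → Prop} {s : Q → Q → Prop} (e : r ≃r s) :
    Nat.card (DecreasingLabelling P r K) = Nat.card (DecreasingLabelling Q s K) :=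
  Nat.card_congr
    { toFun := fun f => ⟨f.1 ∘ e.symm, f.2.1.comp e.symm.bijective,
        fun _ _ h => f.2.2 _ _ (e.symm.map_rel_iff.2 h)⟩
      invFun := fun f => ⟨f.1 ∘ e, f.2.1.comp e.bijective,
        fun _ _ h => f.2.2 _ _ (e.map_rel_iff.2 h)⟩
      left_inv := fun f => Subtype.ext (by ext; simp)
      right_inv := fun f => Subtype.ext (by ext; simp) }

theorem card_congr_right [LinearOrder K] [Finite K] {K' : Type*} [LinearOrder K'] [Finite K']
    (r : P → P → Prop) (h : Nat.card K = Nat.card K') :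
    Nat.card (DecreasingLabelling P r K) = Nat.card (DecreasingLabelling P r K') := by
  have := Fintype.ofFinite K
  have := Fintype.ofFinite K'
  let e : K ≃o K' :=
    (Fintype.orderIsoFinOfCardEq K rfl).symm.trans
      (Fintype.orderIsoFinOfCardEq K' (by simpa [Nat.card_eq_fintype_card] using h.symm))
  exact Nat.card_congr
    { toFun := fun f => ⟨e ∘ f.1, e.bijective.comp f.2.1,
        fun _ _ h => e.lt_iff_lt.2 (f.2.2 _ _ h)⟩
      invFun := fun f => ⟨e.symm ∘ f.1, e.symm.bijective.comp f.2.1,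
        fun _ _ h => e.symm.lt_iff_lt.2 (f.2.2 _ _ h)⟩
      left_inv := fun f => Subtype.ext (by ext; simp)
      right_inv := fun f => Subtype.ext (by ext; simp) }

theorem card_eq_zero [LT K] (r : P → P → Prop) (h : Nat.card P ≠ Nat.card K) :
    Nat.card (DecreasingLabelling P r K) = 0 := by
  have : IsEmpty (DecreasingLabelling P r K) := ⟨fun f => h (Nat.card_eq_of_bijective _ f.2.1)⟩
  exact Nat.card_of_isEmpty

theorem card_of_isEmpty [LT K] [IsEmpty P] [IsEmpty K] (r : P → P → Prop) :
    Nat.card (DecreasingLabelling P r K) = 1 := by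
  rw [Nat.card_eq_one_iff_unique]
  refine ⟨⟨fun f g => Subtype.ext (Subsingleton.elim _ _)⟩,
    ⟨⟨fun p => isEmptyElim p, ⟨fun p => isEmptyElim p, fun k => isEmptyElim k⟩,
      fun p => isEmptyElim p⟩⟩⟩

/-- The relation on `Option P` obtained from `r` by adjoining `none` as a root. -/
def adjoinRoot (r : P → P → Prop) : Option P → Option P → Prop
  | none, some _ => True
  | some u, some v => r u v
  | _, none => False

theorem card_adjoinRoot [Preorder K] (r : P → P → Prop) :
    Nat.card (DecreasingLabelling (Option P) (adjoinRoot r) (WithTop K)) =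
      Nat.card (DecreasingLabelling P r K) := by
  symm
  refine Nat.card_congr (Equiv.ofBijective
    (fun f => ⟨fun x => (x.map f.1 : Option K), ?_, ?_⟩) ⟨?_, ?_⟩)
  · refine ⟨Option.map_injective f.2.1.1, ?_⟩
    rintro (_ | k)
    · exact ⟨none, rfl⟩
    · obtain ⟨p, rfl⟩ := f.2.1.2 k
      exact ⟨some p, rfl⟩
  · rintro (_ | u) (_ | v) h
    · exact h.elim
    · exact WithTop.coe_lt_top (f.1 v)
    · exact h.elim
    · exact WithTop.coe_lt_coe.2 (f.2.2 u v h)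
  · intro f g h
    refine Subtype.ext (funext fun p => ?_)
    have := congrFun (congrArg Subtype.val h) (some p)
    exact Option.some_injective _ this
  · rintro ⟨f, hf, hr⟩
    have hnone : f none = ⊤ := by
      obtain ⟨_ | y, hy⟩ := hf.2 ⊤
      · exact hy
      · exact absurd (hy ▸ hr none (some y) trivial) not_top_lt
    have hsome : ∀ p, ∃ k : K, (k : WithTop K) = f (some p) := fun p => by
      apply WithTop.ne_top_iff_exists.1
      rw [← hnone]
      exact fun h => Option.some_ne_none _ (hf.1 h)
    choose g hg using hsome
    refine ⟨⟨g, ⟨fun a b hab => ?_, fun k => ?_⟩, fun u v h => ?_⟩, ?_⟩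
    · have : f (some a) = f (some b) := by rw [← hg, ← hg, hab]
      exact Option.some_injective _ (hf.1 this)
    · obtain ⟨_ | y, hy⟩ := hf.2 (k : WithTop K)
      · rw [hnone] at hy
        exact absurd hy.symm WithTop.coe_ne_top
      · exact ⟨y, WithTop.coe_injective ((hg y).trans hy)⟩
    · have := hr (some u) (some v) h
      rwa [← hg, ← hg, WithTop.coe_lt_coe] at this
    · refine Subtype.ext (funext ?_)
      rintro (_ | p)
      · exact hnone.symm
      · exact hg p

theorem card_fiber [LinearOrder K] (r : P → P → Prop) (s : Q → Q → Prop) (S : Set K) :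
    Nat.card {f : DecreasingLabelling (P ⊕ Q) (Sum.LiftRel r s) K //
        Set.range (f.1 ∘ Sum.inl) = S} =
      Nat.card (DecreasingLabelling P r S) *
        Nat.card (DecreasingLabelling Q s (Sᶜ : Set K)) := by
  rw [← Nat.card_prod]
  symm
  refine Nat.card_congr (Equiv.ofBijective
    (fun x => ⟨⟨Sum.elim (fun p => (x.1.1 p : K)) (fun q => (x.2.1 q : K)), ⟨?_, ?_⟩, ?_⟩, ?_⟩)
    ⟨?_, ?_⟩)
  · rintro (a | a) (b | b) h
    · exact congrArg _ (x.1.2.1.1 (Subtype.ext h))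
    · exact absurd h (ne_of_mem_of_not_mem (x.1.1 a).2 (x.2.1 b).2)
    · exact absurd h.symm (ne_of_mem_of_not_mem (x.1.1 b).2 (x.2.1 a).2)
    · exact congrArg _ (x.2.2.1.1 (Subtype.ext h))
  · intro k
    by_cases hk : k ∈ S
    · obtain ⟨p, hp⟩ := x.1.2.1.2 ⟨k, hk⟩
      exact ⟨Sum.inl p, congrArg Subtype.val hp⟩
    · obtain ⟨p, hp⟩ := x.2.2.1.2 ⟨k, hk⟩
      exact ⟨Sum.inr p, congrArg Subtype.val hp⟩
  · rintro _ _ (h | h)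
    · exact x.1.2.2 _ _ h
    · exact x.2.2.2 _ _ h
  · ext k
    constructor
    · rintro ⟨p, rfl⟩
      exact (x.1.1 p).2
    · intro hk
      obtain ⟨p, hp⟩ := x.1.2.1.2 ⟨k, hk⟩
      exact ⟨p, congrArg Subtype.val hp⟩
  · intro x y h
    have h' := congrArg (fun z => z.1.1) h
    refine Prod.ext (Subtype.ext (funext fun p => Subtype.ext ?_))
      (Subtype.ext (funext fun q => Subtype.ext ?_))
    · exact congrFun h' (Sum.inl p)
    · exact congrFun h' (Sum.inr q)
  · rintro ⟨⟨f, hf, hr⟩, rfl⟩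
    have hl : ∀ p, f (Sum.inl p) ∈ Set.range (f ∘ Sum.inl) := fun p => ⟨p, rfl⟩
    have hq : ∀ q, f (Sum.inr q) ∈ (Set.range (f ∘ Sum.inl))ᶜ := by
      rintro q ⟨p, hp⟩
      exact Sum.inl_ne_inr (hf.1 hp)
    refine ⟨⟨⟨fun p => ⟨_, hl p⟩, ⟨fun a b h => ?_, ?_⟩, fun u v h => ?_⟩,
      ⟨fun q => ⟨_, hq q⟩, ⟨fun a b h => ?_, ?_⟩, fun u v h => ?_⟩⟩, ?_⟩
    · exact Sum.inl_injective (hf.1 (congrArg Subtype.val h))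
    · rintro ⟨_, p, rfl⟩
      exact ⟨p, rfl⟩
    · exact hr _ _ (Sum.LiftRel.inl h)
    · exact Sum.inr_injective (hf.1 (congrArg Subtype.val h))
    · rintro ⟨k, hk⟩
      obtain ⟨p | q, rfl⟩ := hf.2 k
      · exact absurd (hl p) hk
      · exact ⟨q, rfl⟩
    · exact hr _ _ (Sum.LiftRel.inr h)
    · refine Subtype.ext (Subtype.ext (funext ?_))
      rintro (p | q) <;> rfl

instance [Finite P] [Finite K] [LT K] (r : P → P → Prop) : Finite (DecreasingLabelling P r K) :=
  inferInstanceAs (Finite {f : P → K // Function.Bijective f ∧ ∀ u v, r u v → f v < f u})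

theorem card_sum [Finite P] [Finite Q] (r : P → P → Prop) (s : Q → Q → Prop) :
    Nat.card (DecreasingLabelling (P ⊕ Q) (Sum.LiftRel r s) (Fin (Nat.card P + Nat.card Q))) =
      (Nat.card P + Nat.card Q).choose (Nat.card P) *
        (Nat.card (DecreasingLabelling P r (Fin (Nat.card P))) *
          Nat.card (DecreasingLabelling Q s (Fin (Nat.card Q)))) := by
  set K := Fin (Nat.card P + Nat.card Q)
  rw [← Nat.card_congr (Equiv.sigmaFiberEquiv
    (fun f : DecreasingLabelling (P ⊕ Q) (Sum.LiftRel r s) K =>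
      (Set.range (f.1 ∘ Sum.inl)).toFinite.toFinset)), Nat.card_sigma]
  have key : ∀ S : Finset K, Nat.card {f : DecreasingLabelling (P ⊕ Q) (Sum.LiftRel r s) K //
        (Set.range (f.1 ∘ Sum.inl)).toFinite.toFinset = S} =
      if S.card = Nat.card P then (Nat.card (DecreasingLabelling P r (Fin (Nat.card P))) *
          Nat.card (DecreasingLabelling Q s (Fin (Nat.card Q)))) else 0 := by
    intro S
    have hS : Nat.card (S : Set K) = S.card := by simp
    have hS' : Nat.card ((S : Set K)ᶜ : Set K) = Nat.card P + Nat.card Q - S.card := by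
      rw [← Finset.coe_compl, Nat.card_coe_set_eq, Set.ncard_coe_finset, Finset.card_compl,
        Fintype.card_fin]
    trans Nat.card {f : DecreasingLabelling (P ⊕ Q) (Sum.LiftRel r s) K //
        Set.range (f.1 ∘ Sum.inl) = (S : Set K)}
    · exact Nat.card_congr (Equiv.subtypeEquivRight fun f => by
        rw [← Finset.coe_inj, Set.Finite.coe_toFinset])
    rw [card_fiber]
    split_ifs with h
    · rw [card_congr_right r (K' := Fin (Nat.card P)) (by rw [hS, h, Nat.card_fin]),
        card_congr_right s (K' := Fin (Nat.card Q)) (by rw [hS', h, Nat.card_fin]; omega)]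
    · rw [card_eq_zero r (by rw [hS]; exact Ne.symm h), zero_mul]
  rw [Finset.sum_congr rfl fun S _ => key S, ← Finset.sum_filter, Finset.sum_const, smul_eq_mul]
  congr 1
  rw [← Finset.powerset_univ, ← Finset.powersetCard_eq_filter, Finset.card_powersetCard]
  simp [K]

end DecreasingLabelling

/-- The strict prefix relation on a set of positions. -/
def strictPrefix {S : List Bool → Prop} (u v : Subtype S) : Prop := u.1 <+: v.1 ∧ u.1 ≠ v.1

namespace BT

/-- The child of `node l r` in the direction `c`. -/
def child : Bool → BT → BT → BT
  | false, l, _ => l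
  | true, _, r => r

/-- `p` is the position of a child in direction `c`. -/
def IsChild (c : Bool) (B : BT) (p : List Bool) : Prop := p ∈ B.paths ∧ p.getLast? = some c

/-- `p` is the position of a child in direction `c` once `B` itself is hung in direction `c`. -/
def IsHungChild (c : Bool) (B : BT) (p : List Bool) : Prop :=
  p ∈ B.paths ∧ (c :: p).getLast? = some c

instance (c : Bool) (B : BT) : Finite (Subtype (B.IsChild c)) :=
  (B.paths.finite_toSet.subset fun _ h => h.1 : {p | B.IsChild c p}.Finite)

instance (c : Bool) (B : BT) : Finite (Subtype (B.IsHungChild c)) :=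
  (B.paths.finite_toSet.subset fun _ h => h.1 : {p | B.IsHungChild c p}.Finite)

theorem cons_mem_paths_node_s8 {b : Bool} {q : List Bool} {l r : BT} :
    b :: q ∈ (node l r).paths ↔ q ∈ (child b l r).paths := by
  cases b <;> simp [paths, child]

theorem nil_mem_paths_node {l r : BT} : [] ∈ (node l r).paths := by simp [paths]

theorem cons_not_isChild {c : Bool} {q : List Bool} {l r : BT} :
    (node l r).IsChild c ((!c) :: q) ↔ (child (!c) l r).IsChild c q := by
  unfold IsChild
  rw [cons_mem_paths_node_s8]
  cases q <;> simp

theorem cons_isChild {c : Bool} {q : List Bool} {l r : BT} :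
    (node l r).IsChild c (c :: q) ↔ (child c l r).IsHungChild c q := by
  unfold IsChild IsHungChild
  rw [cons_mem_paths_node_s8]

/-- Children of a node: those in the subtree in direction `c` (including its root) and those in
the other subtree. -/
noncomputable def isChildNode (c : Bool) (l r : BT) :
    Sum.LiftRel (strictPrefix (S := (child c l r).IsHungChild c))
      (strictPrefix (S := (child (!c) l r).IsChild c)) ≃r
      strictPrefix (S := (node l r).IsChild c) where
  toEquiv := Equiv.ofBijective
    (Sum.elim (fun q => ⟨c :: q.1, cons_isChild.2 q.2⟩)
      (fun q => ⟨(!c) :: q.1, cons_not_isChild.2 q.2⟩)) <| by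
    constructor
    · rintro (⟨a, ha⟩ | ⟨a, ha⟩) (⟨b, hb⟩ | ⟨b, hb⟩) h <;> simp_all
    · rintro ⟨_ | ⟨b, q⟩, hp⟩
      · simp [IsChild] at hp
      · by_cases hb : b = c
        · subst hb
          exact ⟨Sum.inl ⟨q, cons_isChild.1 hp⟩, rfl⟩
        · obtain rfl : b = !c := Bool.eq_not.2 hb
          exact ⟨Sum.inr ⟨q, cons_not_isChild.1 hp⟩, rfl⟩
  map_rel_iff' := by
    rintro (⟨a, ha⟩ | ⟨a, ha⟩) (⟨b, hb⟩ | ⟨b, hb⟩)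
    · change (c :: a <+: c :: b ∧ c :: a ≠ c :: b) ↔ _
      simp [strictPrefix]
    · change (c :: a <+: (!c) :: b ∧ c :: a ≠ (!c) :: b) ↔ _
      simp
    · change ((!c) :: a <+: c :: b ∧ (!c) :: a ≠ c :: b) ↔ _
      simp
    · change ((!c) :: a <+: (!c) :: b ∧ (!c) :: a ≠ (!c) :: b) ↔ _
      simp [strictPrefix]

/-- Hanging a nonempty tree turns its root into a child which is an ancestor of all others. -/
noncomputable def isHungChildNode (c : Bool) (l r : BT) :
    DecreasingLabelling.adjoinRoot (strictPrefix (S := (node l r).IsChild c)) ≃r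
      strictPrefix (S := (node l r).IsHungChild c) where
  toEquiv := Equiv.ofBijective
    (fun x => x.elim ⟨[], nil_mem_paths_node, rfl⟩
      (fun q => ⟨q.1, q.2.1, by rw [List.getLast?_cons, q.2.2]; rfl⟩)) <| by
    constructor
    · rintro (_ | ⟨a, ha⟩) (_ | ⟨b, hb⟩) h
      · rfl
      · obtain rfl : [] = b := congrArg Subtype.val h
        simp [IsChild] at hb
      · obtain rfl : a = [] := congrArg Subtype.val h
        simp [IsChild] at ha
      · obtain rfl : a = b := congrArg Subtype.val h
        rfl
    · rintro ⟨_ | ⟨b, q⟩, hp⟩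
      · exact ⟨none, rfl⟩
      · exact ⟨some ⟨b :: q, hp.1, by simpa [IsHungChild] using hp.2⟩, rfl⟩
  map_rel_iff' := by
    rintro (_ | ⟨a, ha⟩) (_ | ⟨b, hb⟩)
    · change ([] <+: [] ∧ [] ≠ []) ↔ False
      simp
    · change ([] <+: b ∧ [] ≠ b) ↔ True
      have : [] ≠ b := by
        rintro rfl
        simp [IsChild] at hb
      simp [this]
    · change (a <+: [] ∧ a ≠ []) ↔ False
      simp
    · exact Iff.rfl

/-- `0` for the empty tree and `1` otherwise. -/
def rootCount : BT → ℕ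
  | nil => 0
  | node _ _ => 1

theorem rootCount_node (l r : BT) : (node l r).rootCount = 1 := rfl

/-- The number of children in direction `c`. -/
def childCount (c : Bool) : BT → ℕ
  | nil => 0
  | node l r => childCount c l + childCount c r + (child c l r).rootCount

/-- The number of decreasing labellings of the children in direction `c`. -/
def labelCount (c : Bool) : BT → ℕ
  | nil => 1
  | node l r =>
    (childCount c (node l r)).choose (childCount c (child c l r) + (child c l r).rootCount) *
      (labelCount c l * labelCount c r)

theorem isEmpty_isHungChild_nil (c : Bool) : IsEmpty (Subtype (nil.IsHungChild c)) :=
  ⟨fun p => by simpa [IsHungChild, paths] using p.2⟩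

theorem isEmpty_isChild_nil (c : Bool) : IsEmpty (Subtype (nil.IsChild c)) :=
  ⟨fun p => by simpa [IsChild, paths] using p.2⟩

theorem card_isHungChild (c : Bool) (B : BT) :
    Nat.card (Subtype (B.IsHungChild c)) = Nat.card (Subtype (B.IsChild c)) + B.rootCount := by
  cases B with
  | nil =>
    have := isEmpty_isHungChild_nil c
    have := isEmpty_isChild_nil c
    simp [rootCount]
  | node l r =>
    rw [← Nat.card_congr (isHungChildNode c l r).toEquiv, Finite.card_option]
    rfl

theorem card_isChild_node (c : Bool) (l r : BT) :
    Nat.card (Subtype ((node l r).IsChild c)) =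
      Nat.card (Subtype ((child c l r).IsHungChild c)) +
        Nat.card (Subtype ((child (!c) l r).IsChild c)) := by
  rw [← Nat.card_congr (isChildNode c l r).toEquiv, Nat.card_sum]

theorem card_isChild (c : Bool) (B : BT) :
    Nat.card (Subtype (B.IsChild c)) = childCount c B := by
  induction B with
  | nil =>
    have := isEmpty_isChild_nil c
    simp [childCount]
  | node l r hl hr =>
    rw [card_isChild_node, card_isHungChild]
    cases c <;> simp only [child, childCount, hl, hr, Bool.not_true, Bool.not_false] <;> ring

/-- The number of decreasing labellings of a set of positions. -/
noncomputable def decreasingCount (S : List Bool → Prop) : ℕ :=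
  Nat.card (DecreasingLabelling (Subtype S) strictPrefix (Fin (Nat.card (Subtype S))))

theorem decreasingCount_isHungChild (c : Bool) (B : BT) :
    decreasingCount (B.IsHungChild c) = decreasingCount (B.IsChild c) := by
  unfold decreasingCount
  cases B with
  | nil =>
    have := isEmpty_isHungChild_nil c
    have := isEmpty_isChild_nil c
    have h1 : IsEmpty (Fin (Nat.card (Subtype (nil.IsHungChild c)))) := by
      rw [Nat.card_of_isEmpty]; infer_instance
    have h2 : IsEmpty (Fin (Nat.card (Subtype (nil.IsChild c)))) := by
      rw [Nat.card_of_isEmpty]; infer_instance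
    rw [DecreasingLabelling.card_of_isEmpty, DecreasingLabelling.card_of_isEmpty]
  | node l r =>
    rw [← DecreasingLabelling.card_congr (isHungChildNode c l r),
      ← DecreasingLabelling.card_adjoinRoot (strictPrefix (S := (node l r).IsChild c))]
    set n := Nat.card (Subtype ((node l r).IsChild c))
    refine DecreasingLabelling.card_congr_right _ ?_
    rw [Nat.card_fin, card_isHungChild]
    exact ((Finite.card_option (α := Fin n)).trans (by rw [Nat.card_fin]; rfl)).symm

theorem decreasingCount_isChild (c : Bool) (B : BT) :
    decreasingCount (B.IsChild c) = labelCount c B := by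
  induction B with
  | nil =>
    have := isEmpty_isChild_nil c
    have : IsEmpty (Fin (Nat.card (Subtype (nil.IsChild c)))) := by
      rw [Nat.card_of_isEmpty]; infer_instance
    exact DecreasingLabelling.card_of_isEmpty _
  | node l r hl hr =>
    have h : decreasingCount ((node l r).IsChild c) =
        (Nat.card (Subtype ((node l r).IsChild c))).choose
          (Nat.card (Subtype ((child c l r).IsHungChild c))) *
        (decreasingCount ((child c l r).IsHungChild c) *
          decreasingCount ((child (!c) l r).IsChild c)) := by
      rw [card_isChild_node]
      refine Eq.trans ?_ (DecreasingLabelling.card_sum _ _)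
      rw [DecreasingLabelling.card_congr (isChildNode c l r), ← card_isChild_node]
      rfl
    rw [h, decreasingCount_isHungChild, card_isHungChild, card_isChild, card_isChild, labelCount]
    cases c <;> simp only [child, hl, hr, Bool.not_true, Bool.not_false]
    ring

theorem mem_leftVertices {B : BT} {p : List Bool} : p ∈ B.leftVertices ↔ B.IsChild false p := by
  simp [leftVertices, IsChild]

theorem mem_rightVertices {B : BT} {p : List Bool} : p ∈ B.rightVertices ↔ B.IsChild true p := by
  simp [rightVertices, IsChild]

theorem card_eq_childCount {B : BT} {c : Bool} {V : Finset (List Bool)}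
    (hV : ∀ p, p ∈ V ↔ B.IsChild c p) : V.card = childCount c B := by
  rw [← card_isChild, ← Nat.card_congr (Equiv.subtypeEquivRight hV)]
  simp

theorem card_leftVertices (B : BT) : B.leftVertices.card = childCount false B :=
  card_eq_childCount fun _ => mem_leftVertices

theorem card_rightVertices (B : BT) : B.rightVertices.card = childCount true B :=
  card_eq_childCount fun _ => mem_rightVertices

theorem card_decreasingLabelling_finset {B : BT} {c : Bool} {V : Finset (List Bool)}
    (hV : ∀ p, p ∈ V ↔ B.IsChild c p) :
    Nat.card (DecreasingLabelling {p // p ∈ V} strictPrefix (Fin V.card)) = labelCount c B := by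
  have h : B.IsChild c = (· ∈ V) := funext fun p => propext (hV p).symm
  rw [← decreasingCount_isChild, decreasingCount, h]
  exact DecreasingLabelling.card_congr_right _ (by simp)

/-- A non-ambiguous tree is a pair of decreasing labellings. -/
def natEquiv (B : BT) : NAT B ≃
    DecreasingLabelling {p // p ∈ B.leftVertices} strictPrefix (Fin B.leftVertices.card) ×
      DecreasingLabelling {p // p ∈ B.rightVertices} strictPrefix (Fin B.rightVertices.card) where
  toFun T := (⟨T.fL, T.bijL, fun u v h => T.ancL u v h.1 (ne_of_apply_ne _ h.2)⟩,
    ⟨T.fR, T.bijR, fun u v h => T.ancR u v h.1 (ne_of_apply_ne _ h.2)⟩)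
  invFun x := ⟨x.1.1, x.2.1, x.1.2.1, x.2.2.1, fun u v h h' => x.1.2.2 u v ⟨h, Subtype.coe_ne_coe.2 h'⟩,
    fun u v h h' => x.2.2.2 u v ⟨h, Subtype.coe_ne_coe.2 h'⟩⟩
  left_inv _ := rfl
  right_inv _ := rfl

instance (B : BT) : Finite (NAT B) := Finite.of_equiv _ (natEquiv B).symm

theorem card_NAT (B : BT) : Nat.card (NAT B) = labelCount false B * labelCount true B := by
  rw [Nat.card_congr (natEquiv B), Nat.card_prod,
    card_decreasingLabelling_finset fun _ => mem_leftVertices,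
    card_decreasingLabelling_finset fun _ => mem_rightVertices]

/-- The binary trees of height at most `N`. -/
def treesOfHeightLE : ℕ → Finset BT
  | 0 => {nil}
  | N + 1 => insert nil
      ((treesOfHeightLE N ×ˢ treesOfHeightLE N).image fun x => node x.1 x.2)

theorem sum_treesOfHeightLE_succ {M : Type*} [AddCommMonoid M] (N : ℕ) (g : BT → M) :
    ∑ B ∈ treesOfHeightLE (N + 1), g B =
      g nil + ∑ l ∈ treesOfHeightLE N, ∑ r ∈ treesOfHeightLE N, g (node l r) := by
  rw [treesOfHeightLE, Finset.sum_insert (by simp), Finset.sum_image, Finset.sum_product]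
  rintro ⟨a, b⟩ _ ⟨c, d⟩ _ h
  simpa using h

theorem mem_treesOfHeightLE {B : BT} {N : ℕ}
    (h : childCount false B + childCount true B + B.rootCount ≤ N) : B ∈ treesOfHeightLE N := by
  induction B generalizing N with
  | nil => cases N <;> simp [treesOfHeightLE]
  | node l r hl hr =>
    simp only [childCount, child, rootCount_node] at h
    obtain ⟨N, rfl⟩ : ∃ M, N = M + 1 := ⟨N - 1, by omega⟩
    simp [treesOfHeightLE, hl (N := N) (by omega), hr (N := N) (by omega)]

theorem leftChain_le (B : BT) : B.leftChain ≤ childCount false B + B.rootCount := by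
  induction B with
  | nil => simp [leftChain]
  | node l r hl _ => simp only [leftChain, childCount, child, rootCount_node]; omega

theorem rightChain_le (B : BT) : B.rightChain ≤ childCount true B + B.rootCount := by
  induction B with
  | nil => simp [rightChain]
  | node l r _ hr => simp only [rightChain, childCount, child, rootCount_node]; omega

theorem lo_le (B : BT) : B.lo ≤ childCount false B := by
  cases B with
  | nil => simp [lo]
  | node l r => have := leftChain_le l; simp only [lo, childCount, child]; omega

theorem ro_le (B : BT) : B.ro ≤ childCount true B := by
  cases B with
  | nil => simp [ro]
  | node l r => have := rightChain_le r; simp only [ro, childCount, child]; omega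

section WeightedSums

variable {R : Type*} [CommRing R]

/-- The number of non-ambiguous trees of shape `B`, in `R`. -/
def weight (R : Type*) [CommRing R] (B : BT) : R := (labelCount false B * labelCount true B : ℕ)

/-- Sum over the trees of height at most `N` hung as left subtrees, weighted by `f`. -/
def leftSum (f : BT → R) (N m n : ℕ) : R :=
  ∑ B ∈ treesOfHeightLE N,
    if childCount false B + B.rootCount = m ∧ childCount true B = n then f B * weight R B else 0

/-- Sum over the trees of height at most `N` hung as right subtrees, weighted by `f`. -/
def rightSum (f : BT → R) (N m n : ℕ) : R :=
  ∑ B ∈ treesOfHeightLE N,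
    if childCount false B = m ∧ childCount true B + B.rootCount = n then f B * weight R B else 0

theorem sum_antidiagonal_ite {a b c d m n : ℕ} (x y : R) :
    ∑ p ∈ Finset.HasAntidiagonal.antidiagonal m, ∑ q ∈ Finset.HasAntidiagonal.antidiagonal n,
      (m.choose p.1 : R) * (n.choose q.1 : R) *
        ((if a = p.1 ∧ b = q.1 then x else 0) * (if c = p.2 ∧ d = q.2 then y else 0)) =
      if a + c = m ∧ b + d = n then (m.choose a : R) * (n.choose b : R) * (x * y) else 0 := by
  split_ifs with h
  · obtain ⟨rfl, rfl⟩ := h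
    rw [Finset.sum_eq_single (a, c), Finset.sum_eq_single (b, d)]
    · simp
    · rintro ⟨q, q'⟩ _ hq
      by_cases h : b = q ∧ d = q'
      · exact absurd (by rw [h.1, h.2]) hq
      · rw [not_and_or] at h
        rcases h with h | h <;> simp [h]
    · simp
    · rintro ⟨p, p'⟩ _ hp
      refine Finset.sum_eq_zero fun q _ => ?_
      by_cases h : a = p ∧ c = p'
      · exact absurd (by rw [h.1, h.2]) hp
      · rw [not_and_or] at h
        rcases h with h | h <;> simp [h]
    · simp
  · refine Finset.sum_eq_zero fun p hp => Finset.sum_eq_zero fun q hq => ?_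
    have hp := Finset.HasAntidiagonal.mem_antidiagonal.1 hp
    have hq := Finset.HasAntidiagonal.mem_antidiagonal.1 hq
    by_cases h1 : a = p.1 ∧ b = q.1
    · by_cases h2 : c = p.2 ∧ d = q.2
      · exact absurd ⟨by omega, by omega⟩ h
      · simp [h2]
    · simp [h1]

theorem weight_node (l r : BT) :
    weight R (node l r) =
      ((childCount false (node l r)).choose (childCount false l + l.rootCount) : R) *
        ((childCount true (node l r)).choose (childCount true l) : R) *
        (weight R l * weight R r) := by
  have h : (childCount true (node l r)).choose (childCount true r + r.rootCount) =
      (childCount true (node l r)).choose (childCount true l) :=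
    Nat.choose_symm_of_eq_add (by simp only [childCount, child]; ring)
  simp only [weight, labelCount, child, h]
  push_cast
  ring

theorem sum_node (f g : BT → R) (N m n : ℕ) :
    ∑ l ∈ treesOfHeightLE N, ∑ r ∈ treesOfHeightLE N,
      (if childCount false (node l r) = m ∧ childCount true (node l r) = n then
        f l * g r * weight R (node l r) else 0) =
      binomConv₂ (leftSum f N) (rightSum g N) m n := by
  unfold binomConv₂ leftSum rightSum
  simp only [Finset.sum_mul_sum]
  simp only [Finset.mul_sum]
  symm
  rw [Finset.sum_congr rfl fun x _ => Finset.sum_comm, Finset.sum_comm]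
  refine Finset.sum_congr rfl fun l _ => ?_
  rw [Finset.sum_congr rfl fun x _ => Finset.sum_comm, Finset.sum_comm]
  refine Finset.sum_congr rfl fun r _ => ?_
  rw [sum_antidiagonal_ite]
  have h1 : childCount false l + l.rootCount + childCount false r =
      childCount false (node l r) := by simp only [childCount, child]; ring
  have h2 : childCount true l + (childCount true r + r.rootCount) =
      childCount true (node l r) := by simp only [childCount, child]; ring
  rw [h1, h2]
  split_ifs with h
  · rw [weight_node, h.1, h.2]
    ring
  · rfl

theorem leftSum_succ_succ (s : R) (N m n : ℕ) :
    leftSum (fun B => s ^ B.leftChain) (N + 1) (m + 1) n =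
      s * binomConv₂ (leftSum (fun B => s ^ B.leftChain) N)
        (rightSum (fun B => 1 ^ B.rightChain) N) m n := by
  rw [← sum_node, leftSum, sum_treesOfHeightLE_succ]
  simp only [Finset.mul_sum, mul_ite, mul_zero]
  rw [if_neg (by simp [childCount, rootCount]), zero_add]
  refine Finset.sum_congr rfl fun l _ => Finset.sum_congr rfl fun r _ => ?_
  simp only [rootCount, Nat.add_right_cancel_iff, leftChain]
  split_ifs
  · ring
  · rfl

theorem rightSum_succ_succ (t : R) (N m n : ℕ) :
    rightSum (fun B => t ^ B.rightChain) (N + 1) m (n + 1) =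
      t * binomConv₂ (leftSum (fun B => 1 ^ B.leftChain) N)
        (rightSum (fun B => t ^ B.rightChain) N) m n := by
  rw [← sum_node, rightSum, sum_treesOfHeightLE_succ]
  simp only [Finset.mul_sum, mul_ite, mul_zero]
  rw [if_neg (by simp [childCount, rootCount]), zero_add]
  refine Finset.sum_congr rfl fun l _ => Finset.sum_congr rfl fun r _ => ?_
  simp only [rootCount, Nat.add_right_cancel_iff, rightChain]
  split_ifs
  · ring
  · rfl

theorem leftSum_zero (s : R) (N n : ℕ) :
    leftSum (fun B => s ^ B.leftChain) N 0 n = if n = 0 then 1 else 0 := by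
  cases N with
  | zero => simp [leftSum, treesOfHeightLE, childCount, rootCount, leftChain, weight, labelCount,
      eq_comm]
  | succ N =>
    rw [leftSum, sum_treesOfHeightLE_succ]
    simp [childCount, rootCount, leftChain, weight, labelCount, eq_comm]

theorem rightSum_zero (t : R) (N m : ℕ) :
    rightSum (fun B => t ^ B.rightChain) N m 0 = if m = 0 then 1 else 0 := by
  cases N with
  | zero => simp [rightSum, treesOfHeightLE, childCount, rootCount, rightChain, weight, labelCount,
      eq_comm]
  | succ N =>
    rw [rightSum, sum_treesOfHeightLE_succ]
    simp [childCount, rootCount, rightChain, weight, labelCount, eq_comm]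

theorem leftSum_rightSum_eq_natPoly {N m n : ℕ} (h : m + n ≤ N) :
    (∀ s : R, leftSum (fun B => s ^ B.leftChain) N m n = natPoly s 0 m n) ∧
      ∀ t : R, rightSum (fun B => t ^ B.rightChain) N m n = natPoly 0 t m n := by
  induction N generalizing m n with
  | zero =>
    obtain ⟨rfl, rfl⟩ : m = 0 ∧ n = 0 := by omega
    simp only [leftSum_zero, rightSum_zero, natPoly_zero_left, natPoly_zero_right, implies_true,
      and_self]
  | succ N ih =>
    constructor
    · intro s
      cases m with
      | zero => rw [leftSum_zero, natPoly_zero_left]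
      | succ m =>
        rw [leftSum_succ_succ, natPoly_zero_succ_left,
          binomConv₂_congr (fun i hi j hj => (ih (m := i) (n := j) (by omega)).1 s)
            (fun i hi j hj => (ih (m := i) (n := j) (by omega)).2 1),
          binomConv₂_natPoly, add_zero, zero_add]
    · intro t
      cases n with
      | zero => rw [rightSum_zero, natPoly_zero_right]
      | succ n =>
        rw [rightSum_succ_succ, natPoly_zero_succ_right,
          binomConv₂_congr (fun i hi j hj => (ih (m := i) (n := j) (by omega)).1 1)
            (fun i hi j hj => (ih (m := i) (n := j) (by omega)).2 t),
          binomConv₂_natPoly, add_zero, zero_add]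

theorem sum_weight_eq_natPoly (s t : R) (m n : ℕ) :
    ∑ B ∈ treesOfHeightLE (m + n + 1),
      (if B ≠ nil ∧ childCount false B = m ∧ childCount true B = n then
        s ^ B.lo * t ^ B.ro * weight R B else 0) = natPoly s t m n := by
  rw [sum_treesOfHeightLE_succ, if_neg (by simp), zero_add]
  simp only [ne_eq, reduceCtorEq, not_false_eq_true, true_and, lo, ro]
  rw [sum_node (fun l => s ^ l.leftChain) (fun r => t ^ r.rightChain),
    binomConv₂_congr
      (fun i hi j hj => (leftSum_rightSum_eq_natPoly (N := m + n) (by omega)).1 s)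
      (fun i hi j hj => (leftSum_rightSum_eq_natPoly (N := m + n) (by omega)).2 t),
    binomConv₂_natPoly, add_zero, zero_add]

end WeightedSums

end BT

theorem natCountLR_eq_sum (R : Type*) [CommRing R] (a b i j : ℕ) :
    (natCountLR a b i j : R) =
      ∑ B ∈ BT.treesOfHeightLE (a + b + 1),
        if B ≠ BT.nil ∧ B.childCount false = a ∧ B.childCount true = b then
          if B.lo = i then if B.ro = j then B.weight R else 0 else 0 else 0 := by
  simp only [← ite_and]
  rw [← Finset.sum_filter, natCountLR]
  set F := (BT.treesOfHeightLE (a + b + 1)).filter fun B =>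
    (B ≠ BT.nil ∧ B.childCount false = a ∧ B.childCount true = b) ∧ B.lo = i ∧ B.ro = j with hF
  have hmem : ∀ B : BT, (B ≠ BT.nil ∧ B.leftVertices.card = a ∧ B.rightVertices.card = b ∧
      B.lo = i ∧ B.ro = j) ↔ B ∈ F := by
    intro B
    rw [hF, Finset.mem_filter, BT.card_leftVertices, BT.card_rightVertices]
    constructor
    · rintro ⟨h, ha, hb, hi, hj⟩
      refine ⟨BT.mem_treesOfHeightLE ?_, ⟨h, ha, hb⟩, hi, hj⟩
      have : B.rootCount ≤ 1 := by cases B <;> simp [BT.rootCount]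
      omega
    · rintro ⟨-, ⟨h, ha, hb⟩, hi, hj⟩
      exact ⟨h, ha, hb, hi, hj⟩
  rw [Nat.card_congr (Equiv.subtypeEquivRight (q := fun T : Σ B, NAT B => T.1 ∈ F) fun T => hmem T.1),
    Nat.card_congr (Equiv.subtypeSigmaEquiv NAT (· ∈ F)), Nat.card_sigma,
    Finset.sum_coe_sort F fun B => Nat.card (NAT B)]
  simp only [BT.card_NAT, Nat.cast_sum, BT.weight]

theorem sum_natCountLR {R : Type*} [CommRing R] (s t : R) (m n : ℕ) :
    ∑ i ∈ Finset.range (m + 1), ∑ j ∈ Finset.range (n + 1),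
      (natCountLR m n i j : R) * s ^ i * t ^ j = natPoly s t m n := by
  rw [← BT.sum_weight_eq_natPoly]
  simp only [natCountLR_eq_sum, Finset.sum_mul]
  rw [Finset.sum_congr rfl fun i _ => Finset.sum_comm, Finset.sum_comm]
  refine Finset.sum_congr rfl fun B _ => ?_
  split_ifs with h
  · have hi := BT.lo_le B
    have hj := BT.ro_le B
    rw [h.2.1] at hi
    rw [h.2.2] at hj
    simp only [ite_mul, zero_mul, Finset.sum_ite_irrel, Finset.sum_const_zero,
      Finset.sum_ite_eq, Finset.mem_range, Nat.lt_succ_iff, hi, hj, if_true]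
    ring
  · simp

open MvPolynomial in
/-- In `ℤ[α,β]` (with `α = X 0`, `β = X 1`):
`Σ_T α^{LO(T)} β^{RO(T)} = Σ_{p≥1} (p−1)! · (α+β)(α+β+1)⋯(α+β+p−2) ·
 S_{2,α}(w+1,p) · S_{2,β}(h+1,p)`,
the left-hand sum running over all NATs with `w` left and `h` right children. -/
theorem natGF_alpha_beta_eq (w h : ℕ) :
    (∑ i ∈ Finset.range (w + 1), ∑ j ∈ Finset.range (h + 1),
        (natCountLR w h i j : MvPolynomial (Fin 2) ℤ) * (X 0) ^ i * (X 1) ^ j) =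
      ∑ p ∈ Finset.Icc 1 (min w h + 1),
        ((p - 1).factorial : MvPolynomial (Fin 2) ℤ) *
          (∏ j ∈ Finset.range (p - 1), (X 0 + X 1 + (j : MvPolynomial (Fin 2) ℤ))) *
          qStirling (X 0) (w + 1) p * qStirling (X 1) (h + 1) p := by
  rw [sum_natCountLR, natPoly, ← Finset.Ico_succ_right_eq_Icc, Finset.sum_Ico_eq_sum_range]
  refine Finset.sum_congr rfl fun k _ => ?_
  rw [add_comm 1 k, Nat.add_sub_cancel, risingFactorial]
  ring
end
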